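/- Let I = (0,a), 0 < a ≤ ∞, φ an Orlicz function, w a decreasing non-negative weight function on I, and let M_{φ,w} be the class of measurable f on I with M(λf) < ∞ for some λ > 0, where M(f) = ∫_I φ(f*/w) w, equipped with ‖f‖_M = inf{ ε > 0 : M(f/ε) ≤ 1 }. Then the following are equivalent: (i) the dilation operator D₂ maps M_{φ,w} into M_{φ,w}; (ii) D₂ maps M_{φ,w} into M_{φ,w} and is bounded, i.e. ‖D₂f‖_M ≤ C‖f‖_M for some C > 0 and all f ∈ M_{φ,w}; (iii) M_{φ,w} is a linear space; (iv) M_{φ,w} is a linear space and ‖·‖_M is a quasi-norm on it. -/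

import Mathlib

open MeasureTheory Set Filter Topology ENNReal

noncomputable section

namespace OrliczRearrangement

/-- An Orlicz function: convex on `[0,∞)`, strictly increasing on `[0,∞)` and vanishing at `0`. -/
def IsOrliczFn (φ : ℝ → ℝ) : Prop :=
  ConvexOn ℝ (Set.Ici 0) φ ∧ StrictMonoOn φ (Set.Ici 0) ∧ φ 0 = 0

/-- An `N`-function: an Orlicz function with `φ(t)/t → 0` as `t → 0⁺` and `φ(t)/t → ∞`
as `t → ∞`. -/
def IsNFn (φ : ℝ → ℝ) : Prop :=
  IsOrliczFn φ ∧ Filter.Tendsto (fun t => φ t / t) (nhdsWithin 0 (Set.Ioi 0)) (nhds 0) ∧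
    Filter.Tendsto (fun t => φ t / t) Filter.atTop Filter.atTop

/-- The complementary (conjugate) function `φ*(t) = sup_{s>0} (st - φ(s))`. -/
def conjFn (φ : ℝ → ℝ) (t : ℝ) : ℝ := sSup ((fun s => s * t - φ s) '' Set.Ioi 0)

/-- The interval `I = (0,a)`, `0 < a ≤ ∞`, as a subset of `ℝ`. -/
def Ioa' (a : ℝ≥0∞) : Set ℝ := {t : ℝ | 0 < t ∧ ENNReal.ofReal t < a}

/-- Distribution function `d_f(s) = |{t ∈ (0,a) : |f(t)| > s}|`. -/
def distr (a : ℝ≥0∞) (f : ℝ → ℝ) (s : ℝ) : ℝ≥0∞ := volume {t ∈ Ioa' a | s < |f t|}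

/-- Decreasing rearrangement `f*(t) = inf{s ≥ 0 : d_f(s) ≤ t}` of `f` on `(0,a)`,
with value `∞` when no such `s` exists. -/
def decRe (a : ℝ≥0∞) (f : ℝ → ℝ) (t : ℝ) : ℝ≥0∞ :=
  sInf (ENNReal.ofReal '' {s : ℝ | 0 ≤ s ∧ distr a f s ≤ ENNReal.ofReal t})

/-- Distribution of a sequence: `d_x(s) = |{k : |x(k)| > s}|`. -/
def sdistr (x : ℕ → ℝ) (s : ℝ) : ℕ∞ := {k : ℕ | s < |x k|}.encard

/-- Decreasing rearrangement of a sequence (`0`-indexed):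
`x*(n) = inf{s > 0 : d_x(s) ≤ n}`, with value `∞` when no such `s` exists. -/
def sdecRe (x : ℕ → ℝ) (n : ℕ) : ℝ≥0∞ :=
  sInf (ENNReal.ofReal '' {s : ℝ | 0 < s ∧ sdistr x s ≤ (n : ℕ∞)})

/-- The extended-real quantity `φ(c/v)·v`, with the convention that for `v = 0` it equals
`0` if `c = 0` and `∞` if `c ≠ 0`. -/
def oterm (φ : ℝ → ℝ) (c v : ℝ) : ℝ≥0∞ :=
  if v = 0 then (if c = 0 then 0 else ∞) else ENNReal.ofReal (φ (c / v) * v)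

/-- The quantity `φ(c/v)·v` for an extended-real numerator `c`; it equals `∞` when
`c = ∞`. -/
def otermE (φ : ℝ → ℝ) (c : ℝ≥0∞) (v : ℝ) : ℝ≥0∞ :=
  if c = ∞ then ∞ else oterm φ c.toReal v

/-- The modular `M(f) = ∫_I φ(f*/w)·w`. -/
def Mmod (a : ℝ≥0∞) (φ w f : ℝ → ℝ) : ℝ≥0∞ :=
  ∫⁻ t in Ioa' a, otermE φ (decRe a f t) (w t)

/-- The functional `‖f‖_M = inf{ε > 0 : M(f/ε) ≤ 1}` (equal to `∞` if no such `ε`). -/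
def Mnorm (a : ℝ≥0∞) (φ w f : ℝ → ℝ) : ℝ≥0∞ :=
  ⨅ ε ∈ {ε : ℝ | 0 < ε ∧ Mmod a φ w (fun t => f t / ε) ≤ 1}, ENNReal.ofReal ε

/-- The class `M_{φ,w}` of measurable `f` with `M(λf) < ∞` for some `λ > 0`. -/
def Mclass (a : ℝ≥0∞) (φ w : ℝ → ℝ) : Set (ℝ → ℝ) :=
  {f | Measurable f ∧ ∃ c > 0, Mmod a φ w (fun t => c * f t) < ∞}

/-- Submajorization `v ≺ w` on `(0,a)`: `∫₀ᵗ v* ≤ ∫₀ᵗ w*` for all `t ∈ (0,a)`. -/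
def Submaj (a : ℝ≥0∞) (v w : ℝ → ℝ) : Prop :=
  ∀ t ∈ Ioa' a, ∫⁻ s in Set.Ioo 0 t, decRe a v s ≤ ∫⁻ s in Set.Ioo 0 t, decRe a w s

/-- The modular `P`, for (decreasing-rearrangement-like) `[0,∞]`-valued data `F`:
`P(F) = inf{∫_I φ(F/v)·v : v ≥ 0, v ≺ w}`. -/
def PmodE (a : ℝ≥0∞) (φ w : ℝ → ℝ) (F : ℝ → ℝ≥0∞) : ℝ≥0∞ :=
  ⨅ v ∈ {v : ℝ → ℝ | Measurable v ∧ (∀ t, 0 ≤ v t) ∧ Submaj a v w},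
    ∫⁻ t in Ioa' a, otermE φ (F t) (v t)

/-- The modular `P(f) = inf{∫_I φ(|f|/v)·v : v ≥ 0, v ≺ w}`. -/
def Pmod (a : ℝ≥0∞) (φ w f : ℝ → ℝ) : ℝ≥0∞ :=
  PmodE a φ w fun t => ENNReal.ofReal |f t|

/-- The norm of `𝓜_{φ,w}` for `[0,∞]`-valued data. -/
def PnormE (a : ℝ≥0∞) (φ w : ℝ → ℝ) (F : ℝ → ℝ≥0∞) : ℝ≥0∞ :=
  ⨅ ε ∈ {ε : ℝ | 0 < ε ∧ PmodE a φ w (fun t => F t / ENNReal.ofReal ε) ≤ 1},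
    ENNReal.ofReal ε

/-- The norm `‖f‖_𝓜 = inf{ε > 0 : P(f/ε) ≤ 1}`. -/
def Pnorm (a : ℝ≥0∞) (φ w f : ℝ → ℝ) : ℝ≥0∞ :=
  PnormE a φ w fun t => ENNReal.ofReal |f t|

/-- The space `𝓜_{φ,w}` of measurable `f` with `P(λf) < ∞` for some `λ > 0`. -/
def Pclass (a : ℝ≥0∞) (φ w : ℝ → ℝ) : Set (ℝ → ℝ) :=
  {f | Measurable f ∧ ∃ c > 0, Pmod a φ w (fun t => c * f t) < ∞}

/-- Sequence submajorization `v ≺ w`. -/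
def sSubmaj (v w : ℕ → ℝ) : Prop :=
  ∀ m : ℕ, ∑ n ∈ Finset.range m, sdecRe v n ≤ ∑ n ∈ Finset.range m, sdecRe w n

/-- Sequence modular `p` for `[0,∞]`-valued data. -/
def spmodE (φ : ℝ → ℝ) (w : ℕ → ℝ) (X : ℕ → ℝ≥0∞) : ℝ≥0∞ :=
  ⨅ v ∈ {v : ℕ → ℝ | (∀ n, 0 ≤ v n) ∧ sSubmaj v w}, ∑' n, otermE φ (X n) (v n)

/-- Sequence modular `p(x) = inf{∑ φ(|x(n)|/v(n))·v(n) : v ≥ 0, v ≺ w}`. -/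
def spmod (φ : ℝ → ℝ) (w x : ℕ → ℝ) : ℝ≥0∞ :=
  spmodE φ w fun n => ENNReal.ofReal |x n|

/-- Sequence norm for `[0,∞]`-valued data. -/
def spnormE (φ : ℝ → ℝ) (w : ℕ → ℝ) (X : ℕ → ℝ≥0∞) : ℝ≥0∞ :=
  ⨅ ε ∈ {ε : ℝ | 0 < ε ∧ spmodE φ w (fun n => X n / ENNReal.ofReal ε) ≤ 1},
    ENNReal.ofReal ε

/-- Sequence norm `‖x‖_𝔪 = inf{ε > 0 : p(x/ε) ≤ 1}`. -/
def spnorm (φ : ℝ → ℝ) (w x : ℕ → ℝ) : ℝ≥0∞ :=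
  spnormE φ w fun n => ENNReal.ofReal |x n|

/-- Dilation operator `D₂f(t) = f(t/2)`, where `f` is extended by `0` outside `(0,a)`. -/
def D2 (a : ℝ≥0∞) (f : ℝ → ℝ) : ℝ → ℝ := fun t => (Ioa' a).indicator f (t / 2)

/-- A measure preserving transformation from `S` onto `S`. -/
def MeasPresOn (σ : ℝ → ℝ) (S : Set ℝ) : Prop :=
  Set.MapsTo σ S S ∧ Set.SurjOn σ S S ∧ Measurable σ ∧
    ∀ A : Set ℝ, A ⊆ S → MeasurableSet A → volume (S ∩ σ ⁻¹' A) = volume A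

/-- Luxemburg norm of the weighted Orlicz space `L_φ(w)` on `(0,a)`. -/
def luxNorm (a : ℝ≥0∞) (φ w g : ℝ → ℝ) : ℝ≥0∞ :=
  ⨅ ε ∈ {ε : ℝ | 0 < ε ∧
      ∫⁻ t in Ioa' a, ENNReal.ofReal (φ (|g t| / ε) * w t) ≤ 1}, ENNReal.ofReal ε

/-- The Orlicz norm of `f` in `Λ_{φ*,w}`, defined by duality with the unit ball of
`L_φ(w)`: `‖f‖⁰ = sup{∫_I f° g w : g ≥ 0, ‖g‖_{L_φ(w)} ≤ 1}`. -/
def lamOnorm (a : ℝ≥0∞) (φ w f : ℝ → ℝ) : ℝ≥0∞ :=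
  ⨆ g ∈ {g : ℝ → ℝ | Measurable g ∧ (∀ t, 0 ≤ g t) ∧ luxNorm a φ w g ≤ 1},
    ∫⁻ t in Ioa' a, decRe a f t * ENNReal.ofReal (g t * w t)

/-- The Orlicz–Lorentz class `Λ_{φs,w}`: measurable `g` whose (finite) decreasing
rearrangement satisfies `∫_I φs(c·g°)·w < ∞` for some `c > 0`. -/
def LamClass (a : ℝ≥0∞) (φs w : ℝ → ℝ) : Set (ℝ → ℝ) :=
  {g | Measurable g ∧ (∀ t ∈ Ioa' a, decRe a g t < ∞) ∧
    ∃ c > 0, ∫⁻ t in Ioa' a, ENNReal.ofReal (φs (c * (decRe a g t).toReal) * w t) < ∞}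

/-- The (generalized right-continuous) inverse `φ⁻¹(y) = inf{s ≥ 0 : φ(s) ≥ y}`. -/
def phiInv (φ : ℝ → ℝ) (y : ℝ) : ℝ := sInf {s : ℝ | 0 ≤ s ∧ y ≤ φ s}

/-! ### The integrand `φ(c/v)·v` -/

lemma IsOrliczFn.nonneg {φ : ℝ → ℝ} (hφ : IsOrliczFn φ) {x : ℝ} (hx : 0 ≤ x) : 0 ≤ φ x := by
  rw [← hφ.2.2]
  exact hφ.2.1.monotoneOn self_mem_Ici hx hx

lemma IsOrliczFn.map_mul_le {φ : ℝ → ℝ} (hφ : IsOrliczFn φ) {c x : ℝ} (hc : 0 ≤ c) (hc1 : c ≤ 1)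
    (hx : 0 ≤ x) : φ (c * x) ≤ c * φ x := by
  have h := hφ.1.2 (x := x) (y := 0) hx self_mem_Ici hc (sub_nonneg.2 hc1) (by ring)
  simpa [hφ.2.2] using h

lemma IsOrliczFn.mul_map_one_le {φ : ℝ → ℝ} (hφ : IsOrliczFn φ) {x : ℝ} (hx : 0 ≤ x) :
    φ 1 * x ≤ φ x + φ 1 := by
  have h1 := hφ.nonneg zero_le_one
  have h2 := hφ.nonneg hx
  rcases le_total x 1 with hx1 | hx1
  · nlinarith
  · have hx0 : 0 < x := by linarith
    have h := hφ.map_mul_le (c := x⁻¹) (x := x) (by positivity) (inv_le_one_of_one_le₀ hx1) hx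
    rw [inv_mul_cancel₀ hx0.ne', inv_mul_eq_div, le_div_iff₀ hx0] at h
    linarith

lemma otermE_top (φ : ℝ → ℝ) (v : ℝ) : otermE φ ∞ v = ∞ := if_pos rfl

lemma otermE_of_ne_top (φ : ℝ → ℝ) {x : ℝ≥0∞} (hx : x ≠ ∞) (v : ℝ) :
    otermE φ x v = oterm φ x.toReal v := if_neg hx

lemma oterm_of_ne_zero (φ : ℝ → ℝ) (c : ℝ) {v : ℝ} (hv : v ≠ 0) :
    oterm φ c v = ENNReal.ofReal (φ (c / v) * v) := if_neg hv

lemma otermE_zero {φ : ℝ → ℝ} (hφ : IsOrliczFn φ) (v : ℝ) : otermE φ 0 v = 0 := by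
  simp [otermE, oterm, hφ.2.2]

lemma otermE_mono {φ : ℝ → ℝ} (hφ : IsOrliczFn φ) {v : ℝ} (hv : 0 ≤ v) {x y : ℝ≥0∞}
    (hxy : x ≤ y) : otermE φ x v ≤ otermE φ y v := by
  rcases eq_or_ne y ∞ with rfl | hy
  · simp [otermE_top]
  have hx : x ≠ ∞ := ne_top_of_le_ne_top hy hxy
  have hle := ENNReal.toReal_mono hy hxy
  rw [otermE_of_ne_top φ hx, otermE_of_ne_top φ hy]
  rcases hv.eq_or_lt with rfl | hv
  · by_cases hy0 : y.toReal = 0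
    · have : x.toReal = 0 := le_antisymm (hy0 ▸ hle) ENNReal.toReal_nonneg
      simp [oterm, hy0, this]
    · simp [oterm, hy0]
  · rw [oterm_of_ne_zero φ _ hv.ne', oterm_of_ne_zero φ _ hv.ne']
    refine ENNReal.ofReal_le_ofReal (mul_le_mul_of_nonneg_right ?_ hv.le)
    exact hφ.2.1.monotoneOn (mem_Ici.2 (by positivity)) (mem_Ici.2 (by positivity)) (by gcongr)

lemma otermE_mul_le {φ : ℝ → ℝ} (hφ : IsOrliczFn φ) {v : ℝ} (hv : 0 ≤ v) {c : ℝ} (hc : 0 < c)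
    (hc1 : c ≤ 1) (x : ℝ≥0∞) :
    otermE φ (ENNReal.ofReal c * x) v ≤ ENNReal.ofReal c * otermE φ x v := by
  have hc0 : ENNReal.ofReal c ≠ 0 := (ENNReal.ofReal_pos.2 hc).ne'
  rcases eq_or_ne x ∞ with rfl | hx
  · rw [otermE_top, ENNReal.mul_top hc0]
    exact le_top
  rw [otermE_of_ne_top φ (ENNReal.mul_ne_top ENNReal.ofReal_ne_top hx), otermE_of_ne_top φ hx,
    ENNReal.toReal_mul, ENNReal.toReal_ofReal hc.le]
  rcases hv.eq_or_lt with rfl | hv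
  · by_cases hx0 : x.toReal = 0
    · simp [oterm, hx0]
    · simp [oterm, hx0, ENNReal.mul_top hc0]
  · rw [oterm_of_ne_zero φ _ hv.ne', oterm_of_ne_zero φ _ hv.ne', ← ENNReal.ofReal_mul hc.le,
      mul_div_assoc, ← mul_assoc]
    refine ENNReal.ofReal_le_ofReal (mul_le_mul_of_nonneg_right ?_ hv.le)
    exact hφ.map_mul_le hc.le hc1 (by positivity)

lemma otermE_add_le {φ : ℝ → ℝ} (hφ : IsOrliczFn φ) {v : ℝ} (hv : 0 ≤ v) (x y : ℝ≥0∞) :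
    otermE φ (x + y) v ≤ otermE φ (2 * x) v + otermE φ (2 * y) v := by
  rcases le_total x y with h | h
  · exact (otermE_mono hφ hv (by rw [two_mul]; gcongr)).trans le_add_self
  · exact (otermE_mono hφ hv (by rw [two_mul]; gcongr)).trans le_self_add

lemma mul_le_otermE_add {φ : ℝ → ℝ} (hφ : IsOrliczFn φ) {v : ℝ} (hv : 0 ≤ v) (x : ℝ≥0∞) :
    ENNReal.ofReal (φ 1) * x ≤ otermE φ x v + ENNReal.ofReal (φ 1 * v) := by
  have h1 := hφ.nonneg zero_le_one
  rcases eq_or_ne x ∞ with rfl | hx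
  · simp [otermE_top]
  rw [otermE_of_ne_top φ hx]
  rcases hv.eq_or_lt with rfl | hv
  · by_cases hx0 : x.toReal = 0
    · rw [(ENNReal.toReal_eq_zero_iff x).1 hx0 |>.resolve_right hx]
      simp
    · simp [oterm, hx0]
  · have hxv : 0 ≤ x.toReal / v := by positivity
    have h := mul_le_mul_of_nonneg_right (hφ.mul_map_one_le hxv) hv.le
    rw [mul_assoc, div_mul_cancel₀ _ hv.ne', add_mul] at h
    have h2 := hφ.nonneg hxv
    rw [oterm_of_ne_zero φ _ hv.ne', ← ENNReal.ofReal_add (by positivity) (by positivity)]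
    nth_rewrite 1 [← ENNReal.ofReal_toReal hx]
    rw [← ENNReal.ofReal_mul h1]
    exact ENNReal.ofReal_le_ofReal h

lemma tsum_otermE_eq_top {φ : ℝ → ℝ} (hφ : IsOrliczFn φ) {v : ℝ} (hv : 0 ≤ v) {x : ℕ → ℝ≥0∞}
    (hx : ⨆ n, x n = ∞) : ∑' n, otermE φ (x n) v = ∞ := by
  have hφ1 : 0 < φ 1 := by
    rw [← hφ.2.2]
    exact hφ.2.1 self_mem_Ici (mem_Ici.2 zero_le_one) one_pos
  have h : ENNReal.ofReal (φ 1) * ⨆ n, x n ≤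
      (∑' n, otermE φ (x n) v) + ENNReal.ofReal (φ 1 * v) := by
    rw [ENNReal.mul_iSup]
    refine iSup_le fun n => (mul_le_otermE_add hφ hv (x n)).trans ?_
    gcongr
    exact ENNReal.le_tsum n
  rw [hx, ENNReal.mul_top (ENNReal.ofReal_pos.2 hφ1).ne', top_le_iff, ENNReal.add_eq_top] at h
  exact h.resolve_right ENNReal.ofReal_ne_top

lemma otermE_half_iSup_le {φ : ℝ → ℝ} (hφ : IsOrliczFn φ) {v : ℝ} (hv : 0 ≤ v) (x : ℕ → ℝ≥0∞) :
    otermE φ ((⨆ n, x n) / 2) v ≤ ∑' n, otermE φ (x n) v := by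
  by_cases htop : ⨆ n, x n = ∞
  · simp [tsum_otermE_eq_top hφ hv htop]
  by_cases h0 : ⨆ n, x n = 0
  · simp [h0, otermE_zero hφ]
  obtain ⟨n, hn⟩ := lt_iSup_iff.1 (ENNReal.half_lt_self h0 htop)
  exact (otermE_mono hφ hv hn.le).trans (ENNReal.le_tsum n)

lemma measurableSet_Ioa' (a : ℝ≥0∞) : MeasurableSet (Ioa' a) :=
  measurableSet_Ioi.inter (ENNReal.measurable_ofReal measurableSet_Iio)

lemma aemeasurable_otermE {φ : ℝ → ℝ} (hφ : IsOrliczFn φ) {a : ℝ≥0∞} {w : ℝ → ℝ}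
    (hw : Measurable w) (hw0 : ∀ t ∈ Ioa' a, 0 ≤ w t) {X : ℝ → ℝ≥0∞} (hX : Measurable X) :
    AEMeasurable (fun t => otermE φ (X t) (w t)) (volume.restrict (Ioa' a)) := by
  set ψ : ℝ → ℝ := fun x => φ (max x 0) with hψ
  have hψm : Measurable ψ := by
    refine Monotone.measurable fun x y hxy => ?_
    exact hφ.2.1.monotoneOn (mem_Ici.2 (le_max_right _ _)) (mem_Ici.2 (le_max_right _ _))
      (max_le_max_right 0 hxy)
  refine ⟨fun t => otermE ψ (X t) (w t), ?_, ?_⟩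
  · unfold otermE oterm
    have hc : Measurable fun t => (X t).toReal := hX.ennreal_toReal
    refine Measurable.ite (hX (measurableSet_singleton _)) measurable_const ?_
    refine Measurable.ite (hw (measurableSet_singleton _)) ?_ ?_
    · exact Measurable.ite (hc (measurableSet_singleton _)) measurable_const measurable_const
    · exact ((hψm.comp (hc.div hw)).mul hw).ennreal_ofReal
  · filter_upwards [ae_restrict_mem (measurableSet_Ioa' a)] with t ht
    have : (0 : ℝ) ≤ (X t).toReal / w t := div_nonneg ENNReal.toReal_nonneg (hw0 t ht)
    simp [otermE, oterm, hψ, max_eq_left this]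

/-! ### Decreasing rearrangements -/

lemma distr_antitone (a : ℝ≥0∞) (f : ℝ → ℝ) : Antitone (distr a f) := fun _ _ h =>
  measure_mono fun _ ht => ⟨ht.1, h.trans_lt ht.2⟩

lemma decRe_le {a : ℝ≥0∞} {f : ℝ → ℝ} {s t : ℝ} (hs : 0 ≤ s)
    (h : distr a f s ≤ ENNReal.ofReal t) : decRe a f t ≤ ENNReal.ofReal s :=
  sInf_le ⟨s, ⟨hs, h⟩, rfl⟩

lemma distr_le_of_decRe_lt {a : ℝ≥0∞} {f : ℝ → ℝ} {s t : ℝ}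
    (h : decRe a f t < ENNReal.ofReal s) : distr a f s ≤ ENNReal.ofReal t := by
  obtain ⟨_, ⟨r, ⟨hr0, hr⟩, rfl⟩, hrs⟩ := sInf_lt_iff.1 h
  exact (distr_antitone a f ((ENNReal.ofReal_lt_ofReal_iff_of_nonneg hr0).1 hrs).le).trans hr

lemma decRe_antitone (a : ℝ≥0∞) (f : ℝ → ℝ) : Antitone (decRe a f) := fun _ _ h =>
  sInf_le_sInf (image_mono fun _ hs => ⟨hs.1, hs.2.trans (ENNReal.ofReal_le_ofReal h)⟩)

lemma decRe_mono {a : ℝ≥0∞} {f g : ℝ → ℝ} (h : ∀ s, 0 ≤ s → distr a f s ≤ distr a g s) (t : ℝ) :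
    decRe a f t ≤ decRe a g t :=
  sInf_le_sInf (image_mono fun s hs => ⟨hs.1, (h s hs.1).trans hs.2⟩)

lemma decRe_mul_le (a : ℝ≥0∞) (f : ℝ → ℝ) {c : ℝ} (hc : 0 < c) (t : ℝ) :
    decRe a (fun u => c * f u) t ≤ ENNReal.ofReal c * decRe a f t := by
  rw [decRe.eq_def a f, sInf_image, ENNReal.mul_iInf_of_ne (by simpa) (by simp)]
  refine le_iInf fun s => ?_
  by_cases hs : s ∈ {s : ℝ | 0 ≤ s ∧ distr a f s ≤ ENNReal.ofReal t}
  · simp only [hs, iInf_pos]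
    rw [← ENNReal.ofReal_mul hc.le]
    refine decRe_le (mul_nonneg hc.le hs.1) ?_
    refine le_trans (measure_mono fun u hu => ?_) hs.2
    refine ⟨hu.1, ?_⟩
    have := hu.2
    rw [abs_mul, abs_of_pos hc] at this
    exact lt_of_mul_lt_mul_left this hc.le
  · have : (ENNReal.ofReal c) * ∞ = ∞ := ENNReal.mul_top (by simpa)
    simp [hs, this]

lemma decRe_mul (a : ℝ≥0∞) (f : ℝ → ℝ) {c : ℝ} (hc : 0 < c) (t : ℝ) :
    decRe a (fun u => c * f u) t = ENNReal.ofReal c * decRe a f t := by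
  refine le_antisymm (decRe_mul_le a f hc t) ?_
  have h := decRe_mul_le a (fun u => c * f u) (inv_pos.2 hc) t
  simp only [inv_mul_cancel_left₀ hc.ne'] at h
  calc ENNReal.ofReal c * decRe a f t
      ≤ ENNReal.ofReal c * (ENNReal.ofReal c⁻¹ * decRe a (fun u => c * f u) t) := by gcongr
    _ = decRe a (fun u => c * f u) t := by
      rw [← mul_assoc, ← ENNReal.ofReal_mul hc.le, mul_inv_cancel₀ hc.ne', ENNReal.ofReal_one,
        one_mul]

lemma decRe_add_le (a : ℝ≥0∞) (f g : ℝ → ℝ) {t : ℝ} (ht : 0 ≤ t) :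
    decRe a (fun u => f u + g u) t ≤ decRe a f (t / 2) + decRe a g (t / 2) := by
  rw [decRe.eq_def a f, decRe.eq_def a g, ENNReal.sInf_add]
  refine le_iInf₂ fun x hx => ?_
  rw [ENNReal.add_sInf]
  refine le_iInf₂ fun y hy => ?_
  obtain ⟨r, ⟨hr0, hr⟩, rfl⟩ := hx
  obtain ⟨s, ⟨hs0, hs⟩, rfl⟩ := hy
  rw [← ENNReal.ofReal_add hr0 hs0]
  refine decRe_le (by positivity) ?_
  calc distr a (fun u => f u + g u) (r + s)
      ≤ volume ({u ∈ Ioa' a | r < |f u|} ∪ {u ∈ Ioa' a | s < |g u|}) := by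
        refine measure_mono fun u hu => ?_
        by_contra hcon
        simp only [mem_union, mem_ofPred_eq, not_or, not_and, not_lt] at hcon
        exact absurd hu.2 (not_lt.2 ((abs_add_le _ _).trans
          (add_le_add (hcon.1 hu.1) (hcon.2 hu.1))))
    _ ≤ ENNReal.ofReal (t / 2) + ENNReal.ofReal (t / 2) :=
        (measure_union_le _ _).trans (add_le_add hr hs)
    _ = ENNReal.ofReal t := by rw [← ENNReal.ofReal_add (by positivity) (by positivity), add_halves]

lemma decRe_le_of_forall_gt {a : ℝ≥0∞} {f : ℝ → ℝ} {t r : ℝ} (htr : t < r)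
    {y : ℝ≥0∞} (h : ∀ u, t < u → u ≤ r → decRe a f u ≤ y) : decRe a f t ≤ y := by
  refine le_of_forall_gt_imp_ge_of_dense fun z hz => ?_
  obtain ⟨s, hs0, hys, hsz⟩ := ENNReal.lt_iff_exists_real_btwn.1 hz
  refine (decRe_le hs0 ?_).trans hsz.le
  have key : ∀ᶠ u in 𝓝[>] t, distr a f s ≤ ENNReal.ofReal u := by
    filter_upwards [Ioc_mem_nhdsGT htr] with u hu
    exact distr_le_of_decRe_lt ((h u hu.1 hu.2).trans_lt hys)
  exact ge_of_tendsto ((ENNReal.continuous_ofReal.tendsto t).mono_left nhdsWithin_le_nhds) key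

lemma volume_preimage_half (S : Set ℝ) : volume ((fun t : ℝ => t / 2) ⁻¹' S) = 2 * volume S := by
  simp [div_eq_mul_inv, Real.volume_preimage_mul_right (a := (2 : ℝ)⁻¹) (by norm_num) S]

lemma distr_D2_le (a : ℝ≥0∞) (f : ℝ → ℝ) {s : ℝ} (hs : 0 ≤ s) :
    distr a (D2 a f) s ≤ 2 * distr a f s := by
  calc distr a (D2 a f) s ≤ volume ((fun t : ℝ => t / 2) ⁻¹' {t ∈ Ioa' a | s < |f t|}) := by
        refine measure_mono fun u hu => ?_
        have h2 := hu.2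
        by_cases h : u / 2 ∈ Ioa' a
        · simp only [D2, indicator_of_mem h] at h2
          exact ⟨h, h2⟩
        · simp only [D2, indicator_of_notMem h, abs_zero] at h2
          exact absurd hs (not_le.2 h2)
    _ = 2 * distr a f s := volume_preimage_half _

lemma decRe_D2_le (a : ℝ≥0∞) (f : ℝ → ℝ) (t : ℝ) : decRe a (D2 a f) t ≤ decRe a f (t / 2) := by
  refine sInf_le_sInf (image_mono fun s hs => ⟨hs.1, (distr_D2_le a f hs.1).trans ?_⟩)
  calc 2 * distr a f s ≤ 2 * ENNReal.ofReal (t / 2) := by gcongr; exact hs.2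
    _ = ENNReal.ofReal t := by
        rw [← ENNReal.ofReal_ofNat, ← ENNReal.ofReal_mul (by norm_num),
          mul_div_cancel₀ _ (by norm_num)]

/-! ### Modulars -/

/-- The modular `∫_I φ(X/w)·w` of `[0,∞]`-valued data. -/
def dataMod (a : ℝ≥0∞) (φ w : ℝ → ℝ) (X : ℝ → ℝ≥0∞) : ℝ≥0∞ :=
  ∫⁻ t in Ioa' a, otermE φ (X t) (w t)

lemma dataMod_mono {a : ℝ≥0∞} {φ w : ℝ → ℝ} (hφ : IsOrliczFn φ) (hw0 : ∀ t ∈ Ioa' a, 0 ≤ w t)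
    {X Y : ℝ → ℝ≥0∞} (h : ∀ t ∈ Ioa' a, X t ≤ Y t) : dataMod a φ w X ≤ dataMod a φ w Y :=
  setLIntegral_mono' (measurableSet_Ioa' a) fun t ht => otermE_mono hφ (hw0 t ht) (h t ht)

lemma dataMod_mul_le {a : ℝ≥0∞} {φ w : ℝ → ℝ} (hφ : IsOrliczFn φ) (hw0 : ∀ t ∈ Ioa' a, 0 ≤ w t)
    {c : ℝ} (hc : 0 < c) (hc1 : c ≤ 1) (X : ℝ → ℝ≥0∞) :
    dataMod a φ w (fun t => ENNReal.ofReal c * X t) ≤ ENNReal.ofReal c * dataMod a φ w X := by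
  unfold dataMod
  rw [← lintegral_const_mul' _ _ ENNReal.ofReal_ne_top]
  exact setLIntegral_mono' (measurableSet_Ioa' a) fun t ht => otermE_mul_le hφ (hw0 t ht) hc hc1 _

lemma dataMod_add_le {a : ℝ≥0∞} {φ w : ℝ → ℝ} (hφ : IsOrliczFn φ) (hw : Measurable w)
    (hw0 : ∀ t ∈ Ioa' a, 0 ≤ w t) {X : ℝ → ℝ≥0∞} (hX : Measurable X) (Y : ℝ → ℝ≥0∞) :
    dataMod a φ w (fun t => X t + Y t) ≤
      dataMod a φ w (fun t => 2 * X t) + dataMod a φ w (fun t => 2 * Y t) := by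
  unfold dataMod
  rw [← lintegral_add_left' (aemeasurable_otermE hφ hw hw0 (hX.const_mul 2))]
  exact setLIntegral_mono' (measurableSet_Ioa' a) fun t ht => otermE_add_le hφ (hw0 t ht) _ _

lemma Mmod_mul (a : ℝ≥0∞) (φ w f : ℝ → ℝ) {c : ℝ} (hc : 0 < c) :
    Mmod a φ w (fun t => c * f t) = dataMod a φ w fun t => ENNReal.ofReal c * decRe a f t := by
  simp only [Mmod, dataMod, decRe_mul a f hc]

lemma ofReal_mul_le_one {θ : ℝ} (hθ : 0 ≤ θ) {K : ℝ≥0∞} (hK : K ≠ ∞) (h : θ * K.toReal ≤ 1) :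
    ENNReal.ofReal θ * K ≤ 1 := by
  rw [← ENNReal.ofReal_toReal hK, ← ENNReal.ofReal_mul hθ, ← ENNReal.ofReal_one]
  exact ENNReal.ofReal_le_ofReal h

lemma exists_Mmod_mul_le_one {a : ℝ≥0∞} {φ w : ℝ → ℝ} (hφ : IsOrliczFn φ)
    (hw0 : ∀ t ∈ Ioa' a, 0 ≤ w t) {f : ℝ → ℝ} (hf : f ∈ Mclass a φ w) :
    ∃ c > 0, Mmod a φ w (fun t => c * f t) ≤ 1 := by
  obtain ⟨-, c, hc, hK⟩ := hf
  set K := Mmod a φ w (fun t => c * f t) with hKdef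
  have hk : 0 ≤ K.toReal := ENNReal.toReal_nonneg
  have hδ : 0 < (K.toReal + 1)⁻¹ := by positivity
  refine ⟨(K.toReal + 1)⁻¹ * c, by positivity, ?_⟩
  simp only [mul_assoc]
  rw [Mmod_mul a φ w (fun t => c * f t) hδ]
  refine (dataMod_mul_le hφ hw0 hδ (inv_le_one_of_one_le₀ (by linarith)) _).trans ?_
  refine ofReal_mul_le_one hδ.le hK.ne ?_
  change _ * K.toReal ≤ 1
  rw [inv_mul_le_iff₀ (by positivity)]
  linarith

lemma mem_Mclass_of_distr_le {a : ℝ≥0∞} {φ w : ℝ → ℝ} (hφ : IsOrliczFn φ)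
    (hw0 : ∀ t ∈ Ioa' a, 0 ≤ w t) {f g : ℝ → ℝ} (hf : f ∈ Mclass a φ w) (hg : Measurable g)
    (h : ∀ s, 0 ≤ s → distr a g s ≤ distr a f s) : g ∈ Mclass a φ w := by
  obtain ⟨-, c, hc, hK⟩ := hf
  refine ⟨hg, c, hc, lt_of_le_of_lt ?_ hK⟩
  rw [Mmod_mul a φ w f hc, Mmod_mul a φ w g hc]
  refine dataMod_mono hφ hw0 fun t _ => ?_
  gcongr
  exact decRe_mono h t

lemma const_mul_mem_Mclass {a : ℝ≥0∞} {φ w : ℝ → ℝ} (hφ : IsOrliczFn φ)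
    (hw0 : ∀ t ∈ Ioa' a, 0 ≤ w t) {f : ℝ → ℝ} (hf : f ∈ Mclass a φ w) (c : ℝ) :
    (fun t => c * f t) ∈ Mclass a φ w := by
  have hb : 0 < |c| + 1 := by positivity
  have hf' : (fun t => (|c| + 1) * f t) ∈ Mclass a φ w := by
    obtain ⟨hfm, k, hk, hK⟩ := hf
    refine ⟨hfm.const_mul _, k / (|c| + 1), by positivity, ?_⟩
    simpa only [← mul_assoc, div_mul_cancel₀ _ hb.ne'] using hK
  refine mem_Mclass_of_distr_le hφ hw0 hf' (hf.1.const_mul c) fun s _ => ?_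
  refine measure_mono fun t ht => ⟨ht.1, ht.2.trans_le ?_⟩
  rw [abs_mul, abs_mul, abs_of_pos hb]
  gcongr
  linarith

lemma measurable_decRe (a : ℝ≥0∞) (f : ℝ → ℝ) : Measurable (decRe a f) :=
  (decRe_antitone a f).measurable

lemma measurable_D2 (a : ℝ≥0∞) {f : ℝ → ℝ} (hf : Measurable f) : Measurable (D2 a f) :=
  (hf.indicator (measurableSet_Ioa' a)).comp (measurable_id.div_const 2)

lemma mem_Ioa'_of_le {a : ℝ≥0∞} {s t : ℝ} (hs : 0 < s) (hst : s ≤ t) (ht : t ∈ Ioa' a) :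
    s ∈ Ioa' a := ⟨hs, (ENNReal.ofReal_le_ofReal hst).trans_lt ht.2⟩

lemma decRe_toReal_le {a : ℝ≥0∞} {F : ℝ → ℝ≥0∞} (hF : Antitone F) (hfin : ∀ t ∈ Ioa' a, F t ≠ ∞)
    {t : ℝ} (ht : t ∈ Ioa' a) : decRe a (fun u => (F u).toReal) t ≤ F t := by
  rw [← ENNReal.ofReal_toReal (hfin t ht)]
  refine decRe_le ENNReal.toReal_nonneg ?_
  calc distr a (fun u => (F u).toReal) (F t).toReal ≤ volume (Ioo 0 t) := by
        refine measure_mono fun u hu => ⟨hu.1.1, ?_⟩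
        by_contra hcon
        refine absurd hu.2 (not_lt.2 ?_)
        rw [abs_of_nonneg ENNReal.toReal_nonneg]
        exact ENNReal.toReal_mono (hfin t ht) (hF (not_lt.1 hcon))
    _ = ENNReal.ofReal t := by simp

lemma le_of_distr_D2_toReal_le {a : ℝ≥0∞} {F : ℝ → ℝ≥0∞} (hF : Antitone F)
    (hfin : ∀ t ∈ Ioa' a, F t ≠ ∞) {s t u : ℝ} (hs : 0 ≤ s) (ht : t ∈ Ioa' a) (hu : t / 2 < u)
    (h : distr a (D2 a fun r => (F r).toReal) s ≤ ENNReal.ofReal t) : F u ≤ ENNReal.ofReal s := by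
  by_contra! hcon
  have ht0 : 0 < t := ht.1
  have hlt : ENNReal.ofReal t < min (ENNReal.ofReal (2 * u)) a :=
    lt_min ((ENNReal.ofReal_lt_ofReal_iff (by linarith)).2 (by linarith)) ht.2
  obtain ⟨r, hr0, htr, hr⟩ := ENNReal.lt_iff_exists_real_btwn.1 hlt
  have hru : r < 2 * u := (ENNReal.ofReal_lt_ofReal_iff_of_nonneg hr0).1 (hr.trans_le (min_le_left _ _))
  have hra : ENNReal.ofReal r < a := hr.trans_le (min_le_right _ _)
  refine absurd (htr.trans_le (le_trans ?_ h)) (lt_irrefl _)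
  calc ENNReal.ofReal r = volume (Ioo 0 r) := by simp
    _ ≤ _ := by
      refine measure_mono fun x hx => ?_
      have hxa : x ∈ Ioa' a := ⟨hx.1, (ENNReal.ofReal_le_ofReal hx.2.le).trans_lt hra⟩
      have hx2 : x / 2 ∈ Ioa' a := mem_Ioa'_of_le (half_pos hx.1) (half_le_self hx.1.le) hxa
      refine ⟨hxa, ?_⟩
      simp only [D2, indicator_of_mem hx2, abs_of_nonneg ENNReal.toReal_nonneg]
      have hxu : x / 2 ≤ u := by linarith [hx.2]
      exact (ENNReal.ofReal_lt_iff_lt_toReal hs (hfin _ hx2)).1 (hcon.trans_le (hF hxu))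

lemma tsum_ofReal_half_pow_succ : ∑' n : ℕ, ENNReal.ofReal ((1 / 2) ^ (n + 1)) = 1 := by
  have h : ∀ n : ℕ, ENNReal.ofReal ((1 / 2) ^ (n + 1)) = (2⁻¹ : ℝ≥0∞) ^ (n + 1) := fun n => by
    rw [ENNReal.ofReal_pow (by norm_num), one_div, ENNReal.ofReal_inv_of_pos (by norm_num),
      ENNReal.ofReal_ofNat]
  simp only [h, ENNReal.tsum_geometric_add_one, ENNReal.one_sub_inv_two, inv_inv]
  exact ENNReal.inv_mul_cancel (by norm_num) (by norm_num)

theorem exists_dilation_bound {a : ℝ≥0∞} {φ w : ℝ → ℝ} (hφ : IsOrliczFn φ) (hw : Measurable w)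
    (hw0 : ∀ t ∈ Ioa' a, 0 ≤ w t) (hD : ∀ f ∈ Mclass a φ w, D2 a f ∈ Mclass a φ w) :
    ∃ c > 0, ∀ f, Mmod a φ w f ≤ 1 →
      dataMod a φ w (fun t => ENNReal.ofReal c * decRe a f (t / 2)) ≤ 1 := by
  by_contra! hcon
  have hpos : ∀ n : ℕ, (0 : ℝ) < (1 / 2) ^ (n + 1) / (n + 1) := fun n => by positivity
  choose! f hf1 hf2 using hcon
  set g : ℕ → ℝ → ℝ := fun n => f ((1 / 2) ^ (n + 1) / (n + 1))
  set X : ℕ → ℝ → ℝ≥0∞ := fun n t => ENNReal.ofReal ((1 / 2) ^ (n + 1)) * decRe a (g n) t with hX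
  set F : ℝ → ℝ≥0∞ := fun t => ⨆ n, X n t
  have hXm : ∀ n, Measurable (X n) := fun n => (measurable_decRe a (g n)).const_mul _
  have hF : Antitone F := fun s t hst =>
    iSup_mono fun n => mul_le_mul_right (decRe_antitone a (g n) hst) _
  have hsum : ∫⁻ t in Ioa' a, ∑' n, otermE φ (X n t) (w t) ≤ 1 := by
    rw [lintegral_tsum fun n => aemeasurable_otermE hφ hw hw0 (hXm n), ← tsum_ofReal_half_pow_succ]
    refine ENNReal.tsum_le_tsum fun n => ?_
    refine (dataMod_mul_le hφ hw0 (by positivity) (pow_le_one₀ (by norm_num) (by norm_num)) _).trans ?_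
    exact mul_le_of_le_one_right' (hf1 _ (hpos n))
  have hfin : ∀ t ∈ Ioa' a, F t ≠ ∞ := by
    intro t ht htop
    refine absurd hsum (not_le.2 ?_)
    calc (1 : ℝ≥0∞) < ∞ := ENNReal.one_lt_top
      _ = ∫⁻ _ in Ioo 0 t, ∞ := by simp [ENNReal.top_mul, ht.1]
      _ ≤ ∫⁻ u in Ioo 0 t, ∑' n, otermE φ (X n u) (w u) := by
        refine setLIntegral_mono' measurableSet_Ioo fun u hu => ?_
        have hu' : u ∈ Ioa' a := mem_Ioa'_of_le hu.1 hu.2.le ht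
        exact (tsum_otermE_eq_top hφ (hw0 u hu') (top_le_iff.1 (htop ▸ hF hu.2.le))).ge
      _ ≤ _ := lintegral_mono_set fun u hu => mem_Ioa'_of_le hu.1 hu.2.le ht
  have hG : (fun t => (F t).toReal) ∈ Mclass a φ w := by
    refine ⟨hF.measurable.ennreal_toReal, 1 / 2, by norm_num, lt_of_le_of_lt ?_ ENNReal.one_lt_top⟩
    rw [Mmod_mul _ _ _ _ (by norm_num)]
    refine le_trans (setLIntegral_mono' (measurableSet_Ioa' a) fun t ht => ?_) hsum
    refine (otermE_mono hφ (hw0 t ht) ?_).trans (otermE_half_iSup_le hφ (hw0 t ht) fun n => X n t)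
    rw [one_div, ENNReal.ofReal_inv_of_pos (by norm_num), ENNReal.ofReal_ofNat, div_eq_mul_inv,
      mul_comm]
    exact mul_le_mul_right (decRe_toReal_le hF hfin ht) 2⁻¹
  obtain ⟨-, c, hc, hK⟩ := hD _ hG
  have hlow : ∀ n, ∀ t ∈ Ioa' a, X n (t / 2) ≤ decRe a (D2 a fun u => (F u).toReal) t := by
    intro n t ht
    have ht0 : 0 < t := ht.1
    refine le_sInf ?_
    rintro _ ⟨s, ⟨hs, hds⟩, rfl⟩
    have hp : (0 : ℝ) < (1 / 2) ^ (n + 1) := by positivity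
    rw [hX]
    simp only
    rw [← decRe_mul a (g n) hp]
    refine decRe_le_of_forall_gt (half_lt_self ht0) fun u hu _ => ?_
    rw [decRe_mul a (g n) hp]
    exact (le_iSup (fun n => X n u) n).trans (le_of_distr_D2_toReal_le hF hfin hs ht hu hds)
  set K := Mmod a φ w (fun t => c * D2 a (fun u => (F u).toReal) t) with hKdef
  obtain ⟨n, hn⟩ := exists_nat_ge (max (1 / c) (K.toReal / c))
  have hn1 : 1 ≤ n * c := (div_le_iff₀ hc).1 ((le_max_left _ _).trans hn)
  have hn2 : K.toReal ≤ n * c := (div_le_iff₀ hc).1 ((le_max_right _ _).trans hn)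
  have hθ : 0 < 1 / ((n + 1) * c) := by positivity
  refine absurd (hf2 _ (hpos n)) (not_lt.2 ?_)
  calc dataMod a φ w (fun t => ENNReal.ofReal ((1 / 2) ^ (n + 1) / (n + 1)) * decRe a (g n) (t / 2))
      ≤ dataMod a φ w (fun t => ENNReal.ofReal (1 / ((n + 1) * c)) *
          (ENNReal.ofReal c * decRe a (D2 a fun u => (F u).toReal) t)) := by
        refine dataMod_mono hφ hw0 fun t ht => ?_
        have h : ((1 / 2 : ℝ) ^ (n + 1) / (n + 1)) =
          1 / ((n + 1) * c) * (c * (1 / 2) ^ (n + 1)) := by field_simp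
        rw [h, ENNReal.ofReal_mul hθ.le, ENNReal.ofReal_mul hc.le, mul_assoc, mul_assoc]
        gcongr
        exact hlow n t ht
    _ ≤ ENNReal.ofReal (1 / ((n + 1) * c)) * K := by
        rw [hKdef, Mmod_mul _ _ _ _ hc]
        refine dataMod_mul_le hφ hw0 hθ ?_ _
        rw [div_le_one (by positivity)]
        linarith
    _ ≤ 1 := by
        refine ofReal_mul_le_one hθ.le hK.ne ?_
        rw [div_mul_eq_mul_div, one_mul, div_le_one (by positivity)]
        linarith

/-! ### Consequences of the dilation bound -/

lemma Mmod_mono {a : ℝ≥0∞} {φ w : ℝ → ℝ} (hφ : IsOrliczFn φ) (hw0 : ∀ t ∈ Ioa' a, 0 ≤ w t)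
    {f g : ℝ → ℝ} (h : ∀ t, |f t| ≤ |g t|) : Mmod a φ w f ≤ Mmod a φ w g :=
  dataMod_mono hφ hw0 fun t _ => decRe_mono
    (fun _ _ => measure_mono fun u hu => ⟨hu.1, hu.2.trans_le (h u)⟩) t

lemma Mnorm_le_ofReal {a : ℝ≥0∞} {φ w f : ℝ → ℝ} {ε : ℝ} (hε : 0 < ε)
    (h : Mmod a φ w (fun t => f t / ε) ≤ 1) : Mnorm a φ w f ≤ ENNReal.ofReal ε :=
  iInf₂_le ε ⟨hε, h⟩

lemma Mmod_D2_le_one {a : ℝ≥0∞} {φ w : ℝ → ℝ} (hφ : IsOrliczFn φ) (hw0 : ∀ t ∈ Ioa' a, 0 ≤ w t)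
    {c : ℝ} (hc : 0 < c) {f : ℝ → ℝ}
    (h : dataMod a φ w (fun t => ENNReal.ofReal c * decRe a f (t / 2)) ≤ 1) :
    Mmod a φ w (fun t => c * D2 a f t) ≤ 1 := by
  rw [Mmod_mul _ _ _ _ hc]
  refine (dataMod_mono hφ hw0 fun t _ => ?_).trans h
  gcongr
  exact decRe_D2_le a f t

lemma Mmod_add_le_one {a : ℝ≥0∞} {φ w : ℝ → ℝ} (hφ : IsOrliczFn φ) (hw : Measurable w)
    (hw0 : ∀ t ∈ Ioa' a, 0 ≤ w t) {c : ℝ} (hc : 0 < c) {f g : ℝ → ℝ}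
    (hf : dataMod a φ w (fun t => ENNReal.ofReal c * decRe a f (t / 2)) ≤ 1)
    (hg : dataMod a φ w (fun t => ENNReal.ofReal c * decRe a g (t / 2)) ≤ 1) :
    Mmod a φ w (fun t => c / 4 * (f t + g t)) ≤ 1 := by
  have hc4 : 0 < c / 4 := by positivity
  have key : ∀ k : ℝ → ℝ, dataMod a φ w (fun t => ENNReal.ofReal c * decRe a k (t / 2)) ≤ 1 →
      dataMod a φ w (fun t => 2 * (ENNReal.ofReal (c / 4) * decRe a k (t / 2))) ≤
        ENNReal.ofReal (1 / 2) := by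
    intro k hk
    have h : ∀ t, 2 * (ENNReal.ofReal (c / 4) * decRe a k (t / 2)) =
        ENNReal.ofReal (1 / 2) * (ENNReal.ofReal c * decRe a k (t / 2)) := fun t => by
      rw [← mul_assoc, ← mul_assoc, ← ENNReal.ofReal_ofNat, ← ENNReal.ofReal_mul (by norm_num),
        ← ENNReal.ofReal_mul (by norm_num)]
      congr 2
      ring
    simp only [h]
    refine (dataMod_mul_le hφ hw0 (by norm_num) (by norm_num) _).trans ?_
    exact mul_le_of_le_one_right' hk
  calc Mmod a φ w (fun t => c / 4 * (f t + g t))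
      ≤ dataMod a φ w (fun t => ENNReal.ofReal (c / 4) * decRe a f (t / 2) +
          ENNReal.ofReal (c / 4) * decRe a g (t / 2)) := by
        rw [Mmod_mul a φ w (fun t => f t + g t) hc4]
        refine dataMod_mono hφ hw0 fun t ht => ?_
        rw [← mul_add]
        gcongr
        exact decRe_add_le a f g ht.1.le
    _ ≤ ENNReal.ofReal (1 / 2) + ENNReal.ofReal (1 / 2) := by
        refine (dataMod_add_le hφ hw hw0 ?_ _).trans (add_le_add (key f hf) (key g hg))
        exact ((measurable_decRe a f).comp (measurable_id.div_const 2)).const_mul _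
    _ = 1 := by
        rw [← ENNReal.ofReal_add (by norm_num) (by norm_num), add_halves, ENNReal.ofReal_one]

lemma Mnorm_D2_le {a : ℝ≥0∞} {φ w : ℝ → ℝ} (hφ : IsOrliczFn φ) (hw0 : ∀ t ∈ Ioa' a, 0 ≤ w t)
    {c : ℝ} (hc : 0 < c) (hB : ∀ f, Mmod a φ w f ≤ 1 →
      dataMod a φ w (fun t => ENNReal.ofReal c * decRe a f (t / 2)) ≤ 1) (f : ℝ → ℝ) :
    Mnorm a φ w (D2 a f) ≤ ENNReal.ofReal c⁻¹ * Mnorm a φ w f := by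
  have hC : ENNReal.ofReal c⁻¹ ≠ 0 := (ENNReal.ofReal_pos.2 (inv_pos.2 hc)).ne'
  rw [← ENNReal.div_le_iff' hC ENNReal.ofReal_ne_top]
  refine le_iInf₂ fun ε hε => ?_
  rw [ENNReal.div_le_iff' hC ENNReal.ofReal_ne_top, ← ENNReal.ofReal_mul (inv_pos.2 hc).le]
  refine Mnorm_le_ofReal (mul_pos (inv_pos.2 hc) hε.1) ?_
  convert Mmod_D2_le_one hφ hw0 hc (hB _ hε.2) using 2
  ext t
  by_cases ht : t / 2 ∈ Ioa' a
  · simp only [D2, indicator_of_mem ht]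
    field_simp
  · simp only [D2, indicator_of_notMem ht, zero_div, mul_zero]

lemma Mnorm_add_le {a : ℝ≥0∞} {φ w : ℝ → ℝ} (hφ : IsOrliczFn φ) (hw : Measurable w)
    (hw0 : ∀ t ∈ Ioa' a, 0 ≤ w t) {c : ℝ} (hc : 0 < c) (hB : ∀ f, Mmod a φ w f ≤ 1 →
      dataMod a φ w (fun t => ENNReal.ofReal c * decRe a f (t / 2)) ≤ 1) (f g : ℝ → ℝ) :
    Mnorm a φ w (fun t => f t + g t) ≤
      ENNReal.ofReal (4 / c) * (Mnorm a φ w f + Mnorm a φ w g) := by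
  have hc4 : 0 < 4 / c := by positivity
  have hC : ENNReal.ofReal (4 / c) ≠ 0 := (ENNReal.ofReal_pos.2 hc4).ne'
  have hsmall : ∀ (k : ℝ → ℝ) (ε η : ℝ), 0 < ε → ε ≤ η → Mmod a φ w (fun t => k t / ε) ≤ 1 →
      Mmod a φ w (fun t => k t / η) ≤ 1 := by
    intro k ε η hε hεη hk
    refine (Mmod_mono hφ hw0 fun t => ?_).trans hk
    rw [abs_div, abs_div, abs_of_pos hε, abs_of_pos (hε.trans_le hεη)]
    gcongr
  rw [← ENNReal.div_le_iff' hC ENNReal.ofReal_ne_top]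
  simp only [Mnorm.eq_def a φ w f, Mnorm.eq_def a φ w g, ← sInf_image]
  rw [ENNReal.sInf_add]
  refine le_iInf₂ fun x hx => ?_
  rw [ENNReal.add_sInf]
  refine le_iInf₂ fun y hy => ?_
  obtain ⟨ε, ⟨hε, hf⟩, rfl⟩ := hx
  obtain ⟨δ, ⟨hδ, hg⟩, rfl⟩ := hy
  rw [ENNReal.div_le_iff' hC ENNReal.ofReal_ne_top, ← ENNReal.ofReal_add hε.le hδ.le,
    ← ENNReal.ofReal_mul hc4.le]
  refine Mnorm_le_ofReal (by positivity) ?_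
  convert Mmod_add_le_one hφ hw hw0 hc (hB _ (hsmall f ε (ε + δ) hε (by linarith) hf))
    (hB _ (hsmall g δ (ε + δ) hδ (by linarith) hg)) using 2
  ext t
  have : ε + δ ≠ 0 := by positivity
  field_simp

lemma add_mem_Mclass {a : ℝ≥0∞} {φ w : ℝ → ℝ} (hφ : IsOrliczFn φ) (hw : Measurable w)
    (hw0 : ∀ t ∈ Ioa' a, 0 ≤ w t) {c : ℝ} (hc : 0 < c) (hB : ∀ f, Mmod a φ w f ≤ 1 →
      dataMod a φ w (fun t => ENNReal.ofReal c * decRe a f (t / 2)) ≤ 1) {f g : ℝ → ℝ}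
    (hf : f ∈ Mclass a φ w) (hg : g ∈ Mclass a φ w) : (fun t => f t + g t) ∈ Mclass a φ w := by
  obtain ⟨k, hk, hfk⟩ := exists_Mmod_mul_le_one hφ hw0 hf
  obtain ⟨l, hl, hgl⟩ := exists_Mmod_mul_le_one hφ hw0 hg
  have hm : 0 < min k l := lt_min hk hl
  have hsmall : ∀ (h : ℝ → ℝ) (r : ℝ), min k l ≤ r → Mmod a φ w (fun t => r * h t) ≤ 1 →
      Mmod a φ w (fun t => min k l * h t) ≤ 1 := by
    intro h r hr hh
    refine (Mmod_mono hφ hw0 fun t => ?_).trans hh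
    rw [abs_mul, abs_mul, abs_of_pos hm, abs_of_pos (hm.trans_le hr)]
    gcongr
  refine ⟨hf.1.add hg.1, c / 4 * min k l, by positivity, lt_of_le_of_lt ?_ ENNReal.one_lt_top⟩
  refine le_of_eq_of_le (congrArg (Mmod a φ w) (funext fun t => ?_))
    (Mmod_add_le_one hφ hw hw0 hc (hB _ (hsmall f k (min_le_left _ _) hfk))
      (hB _ (hsmall g l (min_le_right _ _) hgl)))
  ring

/-! ### Dilations dominated by sums of two equimeasurable copies -/

lemma exists_add_of_shift {a : ℝ≥0∞} {f h : ℝ → ℝ} (hh : Measurable h) {E : Set ℝ} {τ : ℝ}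
    (hE : ∀ t, t ∉ E → h t = 0) (hEI : E ⊆ Ioa' a) (hEτ : ∀ t, t - τ ∈ E → t ∈ Ioa' a ∧ t ∉ E)
    (hdf : ∀ s, 0 ≤ s → distr a h s ≤ distr a f s)
    (hD : ∀ s, 0 ≤ s → distr a (D2 a f) s ≤ 2 * distr a h s) :
    ∃ h₁ h₂ : ℝ → ℝ, Measurable h₁ ∧ Measurable h₂ ∧
      (∀ s, 0 ≤ s → distr a h₁ s ≤ distr a f s) ∧ (∀ s, 0 ≤ s → distr a h₂ s ≤ distr a f s) ∧
      ∀ s, 0 ≤ s → distr a (D2 a f) s ≤ distr a (fun t => h₁ t + h₂ t) s := by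
  have hmem : ∀ {s t : ℝ}, 0 ≤ s → s < |h t| → t ∈ E := fun {s t} hs ht => by
    by_contra hcon
    rw [hE t hcon, abs_zero] at ht
    exact absurd hs (not_le.2 ht)
  have hτ : ∀ S : Set ℝ, volume ((fun t => t - τ) ⁻¹' S) = volume S := fun S =>
    by simpa only [sub_eq_add_neg] using measure_preimage_add_right volume (-τ) S
  refine ⟨h, fun t => h (t - τ), hh, hh.comp (measurable_id.sub_const τ), hdf, fun s hs => ?_,
    fun s hs => (hD s hs).trans ?_⟩
  · refine le_trans ?_ ((hτ _).trans_le (hdf s hs))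
    exact measure_mono fun t ht => ⟨hEI (hmem hs ht.2), ht.2⟩
  · set S := {t ∈ Ioa' a | s < |h t|}
    have hSm : MeasurableSet S :=
      (measurableSet_Ioa' a).inter (measurableSet_lt measurable_const hh.abs)
    calc 2 * distr a h s = volume S + volume ((fun t => t - τ) ⁻¹' S) := by
          rw [hτ, two_mul]
          rfl
      _ = volume (S ∪ (fun t => t - τ) ⁻¹' S) := by
          refine (measure_union' ?_ hSm).symm
          refine Set.disjoint_left.2 fun t ht ht' => ?_
          exact (hEτ t (hmem hs ht'.2)).2 (hmem hs ht.2)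
      _ ≤ _ := by
          refine measure_mono fun t ht => ?_
          rcases ht with ht | ht
          · have h0 : h (t - τ) = 0 := hE _ fun hcon => (hEτ t hcon).2 (hmem hs ht.2)
            exact ⟨ht.1, by simpa [h0] using ht.2⟩
          · have h1 := hEτ t (hmem hs ht.2)
            exact ⟨h1.1, by simpa [hE t h1.2] using ht.2⟩

lemma volume_floor_even (S : Set ℝ) (hS : MeasurableSet S) :
    volume {t : ℝ | ∃ m : ℤ, ⌊t⌋ = 2 * m ∧ t - m ∈ S} = volume S := by
  have h1 : {t : ℝ | ∃ m : ℤ, ⌊t⌋ = 2 * m ∧ t - m ∈ S} =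
      ⋃ m : ℤ, (fun t : ℝ => t - m) ⁻¹' (S ∩ Ico (m : ℝ) (m + 1)) := by
    ext t
    simp only [mem_ofPred_eq, mem_iUnion, mem_preimage, mem_inter_iff, mem_Ico, Int.floor_eq_iff]
    refine exists_congr fun m => ?_
    push_cast
    constructor
    · rintro ⟨⟨h1, h2⟩, h3⟩
      exact ⟨h3, by linarith, by linarith⟩
    · rintro ⟨h3, h1, h2⟩
      exact ⟨⟨by linarith, by linarith⟩, h3⟩
  have h2 : S = ⋃ m : ℤ, S ∩ Ico (m : ℝ) (m + 1) := by
    rw [← inter_iUnion, iUnion_Ico_intCast, inter_univ]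
  have hd : Pairwise (Function.onFun Disjoint fun m : ℤ => S ∩ Ico (m : ℝ) (m + 1)) :=
    fun m n hmn => (pairwise_disjoint_Ico_intCast ℝ hmn).mono inter_subset_right inter_subset_right
  have hm : ∀ m : ℤ, MeasurableSet (S ∩ Ico (m : ℝ) (m + 1)) := fun m => hS.inter measurableSet_Ico
  rw [h1, measure_iUnion]
  · conv_rhs => rw [h2, measure_iUnion hd hm]
    refine tsum_congr fun m => ?_
    simpa only [sub_eq_add_neg] using measure_preimage_add_right volume (-(m : ℝ)) _
  · intro m n hmn
    refine Set.disjoint_left.2 fun t ht ht' => hmn ?_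
    have h3 : ⌊t⌋ = 2 * m := by
      rw [Int.floor_eq_iff]
      push_cast
      constructor <;> linarith [ht.2.1, ht.2.2]
    have h4 : ⌊t⌋ = 2 * n := by
      rw [Int.floor_eq_iff]
      push_cast
      constructor <;> linarith [ht'.2.1, ht'.2.2]
    omega
  · exact fun m => (hm m).preimage (measurable_id.sub_const _)

lemma exists_add_distr_D2_le (a : ℝ≥0∞) {f : ℝ → ℝ} (hf : Measurable f) :
    ∃ h₁ h₂ : ℝ → ℝ, Measurable h₁ ∧ Measurable h₂ ∧
      (∀ s, 0 ≤ s → distr a h₁ s ≤ distr a f s) ∧ (∀ s, 0 ≤ s → distr a h₂ s ≤ distr a f s) ∧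
      ∀ s, 0 ≤ s → distr a (D2 a f) s ≤ distr a (fun t => h₁ t + h₂ t) s := by
  rcases eq_or_ne a ∞ with rfl | ha
  · have hI : ∀ t, t ∈ Ioa' ∞ ↔ 0 < t := fun t => by simp [Ioa']
    have hEm : MeasurableSet {t : ℝ | 0 < t ∧ Even ⌊t⌋} :=
      measurableSet_Ioi.inter (Int.measurable_floor (MeasurableSet.of_discrete (s := {n | Even n})))
    set h : ℝ → ℝ := {t : ℝ | 0 < t ∧ Even ⌊t⌋}.indicator fun t => f (t - (⌊t⌋ / 2 : ℤ)) with hh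
    have hd : ∀ s, 0 ≤ s → distr ∞ h s = distr ∞ f s := by
      intro s hs
      have hS : MeasurableSet {t ∈ Ioa' ∞ | s < |f t|} :=
        (measurableSet_Ioa' _).inter (measurableSet_lt measurable_const hf.abs)
      refine Eq.trans (congrArg volume ?_) (volume_floor_even _ hS)
      ext t
      simp only [mem_ofPred_eq, hI]
      constructor
      · rintro ⟨ht, hst⟩
        by_cases htE : t ∈ {t : ℝ | 0 < t ∧ Even ⌊t⌋}
        · rw [hh, indicator_of_mem htE] at hst
          obtain ⟨m, hm⟩ := htE.2
          have hm2 : ⌊t⌋ / 2 = m := by omega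
          have hm0 : 0 ≤ m := by have := Int.floor_nonneg.2 ht.le; omega
          refine ⟨m, by omega, ?_, hm2 ▸ hst⟩
          rcases hm0.eq_or_lt with rfl | hm0
          · simpa using ht
          · have h1 : ((m + m : ℤ) : ℝ) ≤ t := hm ▸ Int.floor_le t
            have h2 : (0 : ℝ) < m := by exact_mod_cast hm0
            push_cast at h1
            linarith
        · rw [hh, indicator_of_notMem htE, abs_zero] at hst
          exact absurd hs (not_le.2 hst)
      · rintro ⟨m, hm, hpos, hst⟩
        have h1 := (Int.floor_eq_iff.1 hm)
        push_cast at h1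
        have hm0 : 0 ≤ m := by
          have : (0 : ℝ) < m + 1 := by linarith
          have : 0 < m + 1 := by exact_mod_cast this
          omega
        have hm0' : (0 : ℝ) ≤ m := by exact_mod_cast hm0
        have ht : 0 < t := by linarith
        have htE : t ∈ {t : ℝ | 0 < t ∧ Even ⌊t⌋} := ⟨ht, hm ▸ even_two_mul m⟩
        refine ⟨ht, ?_⟩
        rw [hh, indicator_of_mem htE]
        have hm2 : ⌊t⌋ / 2 = m := by omega
        rwa [hm2]
    refine exists_add_of_shift (E := {t : ℝ | 0 < t ∧ Even ⌊t⌋}) (τ := 1) (h := h) ?_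
      (fun t ht => indicator_of_notMem ht _) (fun t ht => (hI t).2 ht.1) ?_
      (fun s hs => (hd s hs).le) (fun s hs => hd s hs ▸ distr_D2_le ∞ f hs)
    · refine Measurable.indicator (hf.comp (measurable_id.sub ?_)) hEm
      exact (Measurable.of_discrete (f := fun n : ℤ => ((n / 2 : ℤ) : ℝ))).comp Int.measurable_floor
    · rintro t ⟨ht0, ht⟩
      refine ⟨(hI t).2 (by linarith), fun h2 => ?_⟩
      rw [Int.floor_sub_one] at ht
      have := h2.2
      rw [Int.even_iff] at ht this
      omega
  · have hI : ∀ t, t ∈ Ioa' a ↔ 0 < t ∧ t < a.toReal := fun t =>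
      and_congr_right fun ht => ENNReal.ofReal_lt_iff_lt_toReal ht.le ha
    have hE : Ioo 0 (a.toReal / 2) ⊆ Ioa' a := fun t ht => (hI t).2 ⟨ht.1, by linarith [ht.1, ht.2]⟩
    set h : ℝ → ℝ := (Ioo 0 (a.toReal / 2)).indicator f with hh
    refine exists_add_of_shift (E := Ioo 0 (a.toReal / 2)) (τ := a.toReal / 2) (h := h)
      (hf.indicator measurableSet_Ioo) (fun t ht => indicator_of_notMem ht _) hE ?_ ?_ ?_
    · rintro t ⟨h1, h2⟩
      exact ⟨(hI t).2 ⟨by linarith, by linarith⟩, fun h3 => by linarith [h3.2]⟩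
    · refine fun s hs => measure_mono fun t ht => ⟨ht.1, ht.2.trans_le ?_⟩
      exact norm_indicator_le_norm_self f t
    · intro s hs
      refine le_trans (measure_mono fun t ht => ?_) (distr_D2_le a h hs)
      refine ⟨ht.1, ht.2.trans_eq ?_⟩
      have h1 := (hI t).1 ht.1
      have h2 : t / 2 ∈ Ioo 0 (a.toReal / 2) := ⟨by linarith, by linarith⟩
      simp only [D2, indicator_of_mem (hE h2), hh, indicator_of_mem h2]

lemma D2_mem_Mclass_of_linear {a : ℝ≥0∞} {φ w : ℝ → ℝ} (hφ : IsOrliczFn φ)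
    (hw0 : ∀ t ∈ Ioa' a, 0 ≤ w t)
    (hL : ∀ f ∈ Mclass a φ w, ∀ g ∈ Mclass a φ w, ∀ c d : ℝ,
      (fun t => c * f t + d * g t) ∈ Mclass a φ w) {f : ℝ → ℝ} (hf : f ∈ Mclass a φ w) :
    D2 a f ∈ Mclass a φ w := by
  obtain ⟨h₁, h₂, hm₁, hm₂, hd₁, hd₂, hd⟩ := exists_add_distr_D2_le a hf.1
  have hsum := hL h₁ (mem_Mclass_of_distr_le hφ hw0 hf hm₁ hd₁) h₂
    (mem_Mclass_of_distr_le hφ hw0 hf hm₂ hd₂) 1 1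
  simp only [one_mul] at hsum
  exact mem_Mclass_of_distr_le hφ hw0 hsum (measurable_D2 a hf.1) hd

/-- the following are equivalent: (i) `D₂` maps `M_{φ,w}` into itself;
(ii) `D₂` maps `M_{φ,w}` into itself and is bounded; (iii) `M_{φ,w}` is a linear space;
(iv) `M_{φ,w}` is a linear space and `‖·‖_M` is a quasi-norm. -/
theorem statement9 (a : ℝ≥0∞) (ha : 0 < a) (φ : ℝ → ℝ) (hφ : IsOrliczFn φ)
    (w : ℝ → ℝ) (hw_meas : Measurable w) (hw_nonneg : ∀ t ∈ Ioa' a, 0 ≤ w t)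
    (hw_dec : ∀ s ∈ Ioa' a, ∀ t ∈ Ioa' a, s ≤ t → w t ≤ w s) :
    ((∀ f ∈ Mclass a φ w, D2 a f ∈ Mclass a φ w) ↔
      ((∀ f ∈ Mclass a φ w, D2 a f ∈ Mclass a φ w) ∧
        ∃ C > 0, ∀ f ∈ Mclass a φ w,
          Mnorm a φ w (D2 a f) ≤ ENNReal.ofReal C * Mnorm a φ w f)) ∧
    ((∀ f ∈ Mclass a φ w, D2 a f ∈ Mclass a φ w) ↔
      (∀ f ∈ Mclass a φ w, ∀ g ∈ Mclass a φ w, ∀ c d : ℝ,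
        (fun t => c * f t + d * g t) ∈ Mclass a φ w)) ∧
    ((∀ f ∈ Mclass a φ w, D2 a f ∈ Mclass a φ w) ↔
      ((∀ f ∈ Mclass a φ w, ∀ g ∈ Mclass a φ w, ∀ c d : ℝ,
          (fun t => c * f t + d * g t) ∈ Mclass a φ w) ∧
        ∃ C > 0, ∀ f ∈ Mclass a φ w, ∀ g ∈ Mclass a φ w,
          Mnorm a φ w (fun t => f t + g t) ≤
            ENNReal.ofReal C * (Mnorm a φ w f + Mnorm a φ w g))) := by
  have hbound := exists_dilation_bound (φ := φ) hφ hw_meas hw_nonneg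
  have hlin : (∀ f ∈ Mclass a φ w, D2 a f ∈ Mclass a φ w) → ∀ f ∈ Mclass a φ w,
      ∀ g ∈ Mclass a φ w, ∀ c d : ℝ, (fun t => c * f t + d * g t) ∈ Mclass a φ w := by
    intro hD f hf g hg c d
    obtain ⟨k, hk, hB⟩ := hbound hD
    exact add_mem_Mclass hφ hw_meas hw_nonneg hk hB (const_mul_mem_Mclass hφ hw_nonneg hf c)
      (const_mul_mem_Mclass hφ hw_nonneg hg d)
  refine ⟨⟨fun hD => ⟨hD, ?_⟩, fun h => h.1⟩,
    ⟨hlin, fun hL f hf => D2_mem_Mclass_of_linear hφ hw_nonneg hL hf⟩,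
    ⟨fun hD => ⟨hlin hD, ?_⟩, fun hL f hf => D2_mem_Mclass_of_linear hφ hw_nonneg hL.1 hf⟩⟩
  · obtain ⟨c, hc, hB⟩ := hbound hD
    exact ⟨c⁻¹, inv_pos.2 hc, fun f _ => Mnorm_D2_le hφ hw_nonneg hc hB f⟩
  · obtain ⟨c, hc, hB⟩ := hbound hD
    exact ⟨4 / c, by positivity, fun f _ g _ => Mnorm_add_le hφ hw_meas hw_nonneg hc hB f g⟩

end OrliczRearrangement

end
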